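/- arXiv:2003.05207 — 4 statements merged into one kernel-verified Lean document; each statement's English description precedes it below -/
import Mathlib

section
/- Triangle-inequality (sum) form of Lemma 1: for any linear map G : V → V, ‖G ((B′_q ∘ ⋯ ∘ B′_1) φ₀)‖ ≤ ‖G φ_q‖ + Σ_{i=0}^{q−1} ( ‖G ((B′_q ∘ ⋯ ∘ B′_{i+1}) (X φ_i))‖ + ‖G ((B′_q ∘ ⋯ ∘ B′_{i+2}) (B_{i+1} (X φ_i)))‖ ). -/
/- Abstract setting: an inner product space `V` over `ℂ`, step maps `B_k` (original oracle)
and `B'_k` (reprogrammed oracle), and a projection `X` onto queries at the reprogrammed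
point, with `B'_k ∘ (id − X) = B_k ∘ (id − X)`.
`comp B i j = B_j ∘ ⋯ ∘ B_{i+1}` (the identity if `j ≤ i`), and `φ_i = comp B 0 i φ₀`. -/

/-- `comp B i j = B_j ∘ ⋯ ∘ B_{i+1}`, the identity if `j ≤ i`. -/
noncomputable def comp {V : Type*} [NormedAddCommGroup V] [InnerProductSpace ℂ V]
    (B : ℕ → (V →ₗ[ℂ] V)) (i : ℕ) : ℕ → (V →ₗ[ℂ] V)
  | 0 => LinearMap.id
  | j + 1 => if i ≤ j then B (j + 1) ∘ₗ comp B i j else LinearMap.id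

theorem comp_self_aux {V : Type*} [NormedAddCommGroup V] [InnerProductSpace ℂ V]
    (B : ℕ → (V →ₗ[ℂ] V)) (i : ℕ) : comp B i i = LinearMap.id := by
  cases i <;> simp [comp]

theorem comp_shift_aux {V : Type*} [NormedAddCommGroup V] [InnerProductSpace ℂ V]
    (B : ℕ → (V →ₗ[ℂ] V)) (i j : ℕ) (h : i < j) (v : V) :
    comp B i j v = comp B (i + 1) j (B (i + 1) v) := by
  induction j with
  | zero => omega
  | succ j ih =>
    rcases Nat.lt_or_ge i j with h1 | h1
    · have e1 : i ≤ j := by omega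
      have e2 : i + 1 ≤ j := by omega
      simp only [comp, e1, e2, if_true, LinearMap.comp_apply]
      rw [ih h1]
    · have : i = j := by omega
      subst this
      rw [comp_self_aux]
      simp [comp, comp_self_aux]

/-- triangle-inequality (sum) form of Lemma 1: for any linear `G`,
`‖G ((B′_q ∘ ⋯ ∘ B′_1) φ₀)‖ ≤ ‖G φ_q‖`
`  + Σ_{i=0}^{q−1} ( ‖G ((B′_q ∘ ⋯ ∘ B′_{i+1}) (X φ_i))‖`
`                  + ‖G ((B′_q ∘ ⋯ ∘ B′_{i+2}) (B_{i+1} (X φ_i)))‖ )`. -/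
theorem triangle_sum_form {V : Type*} [NormedAddCommGroup V] [InnerProductSpace ℂ V]
    (φ₀ : V) (q : ℕ) (hq : 1 ≤ q) (B B' : ℕ → (V →ₗ[ℂ] V)) (X : V →ₗ[ℂ] V)
    (hBB' : ∀ k, 1 ≤ k → k ≤ q → B' k ∘ₗ (LinearMap.id - X) = B k ∘ₗ (LinearMap.id - X))
    (G : V →ₗ[ℂ] V) :
    ‖G (comp B' 0 q φ₀)‖
      ≤ ‖G (comp B 0 q φ₀)‖
          + ∑ i ∈ Finset.range q,
              (‖G (comp B' i q (X (comp B 0 i φ₀)))‖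
                + ‖G (comp B' (i + 1) q (B (i + 1) (X (comp B 0 i φ₀))))‖) := by
  have key : ∀ m, m ≤ q → ‖G (comp B' 0 q φ₀)‖
      ≤ ‖G (comp B' m q (comp B 0 m φ₀))‖
          + ∑ i ∈ Finset.range m,
              (‖G (comp B' i q (X (comp B 0 i φ₀)))‖
                + ‖G (comp B' (i + 1) q (B (i + 1) (X (comp B 0 i φ₀))))‖) := by
    intro m
    induction m with
    | zero => intro _; simp [comp]
    | succ m ih =>
      intro hm
      have h0 := ih (by omega)
      rw [Finset.sum_range_succ]
      have hs : comp B 0 (m + 1) φ₀ = B (m + 1) (comp B 0 m φ₀) := by simp [comp]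
      rw [hs]
      generalize comp B 0 m φ₀ = v at h0 ⊢
      have hk := LinearMap.congr_fun (hBB' (m + 1) (by omega) hm) v
      simp only [LinearMap.comp_apply, LinearMap.sub_apply, LinearMap.id_apply, map_sub] at hk
      have hv : B' (m + 1) v = B (m + 1) v + (B' (m + 1) (X v) - B (m + 1) (X v)) := by
        rw [sub_eq_iff_eq_add] at hk
        rw [hk]; abel
      have h2 : G (comp B' m q v) = G (comp B' (m + 1) q (B (m + 1) v))
          + (G (comp B' m q (X v)) - G (comp B' (m + 1) q (B (m + 1) (X v)))) := by
        rw [comp_shift_aux B' m q hm v, hv, comp_shift_aux B' m q hm (X v)]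
        simp only [map_add, map_sub]
      have h3 := norm_add_le (G (comp B' (m + 1) q (B (m + 1) v)))
        (G (comp B' m q (X v)) - G (comp B' (m + 1) q (B (m + 1) (X v))))
      have h4 := norm_sub_le (G (comp B' m q (X v)))
        (G (comp B' (m + 1) q (B (m + 1) (X v))))
      rw [← h2] at h3
      linarith
  have := key q le_rfl
  rwa [comp_self_aux, LinearMap.id_apply] at this
end

section
/- Squared form of Lemma 1 (abstract): for any linear map G : V → V, ‖G ((B′_q ∘ ⋯ ∘ B′_1) φ₀)‖² ≤ (2q+1) · ( ‖G φ_q‖² + Σ_{i=0}^{q−1} ( ‖G ((B′_q ∘ ⋯ ∘ B′_{i+1}) (X φ_i))‖² + ‖G ((B′_q ∘ ⋯ ∘ B′_{i+2}) (B_{i+1} (X φ_i)))‖² ) ); equivalently, the average of the 2q+1 squared norms on the right-hand side is at least ‖G ((B′_q ∘ ⋯ ∘ B′_1) φ₀)‖² / (2q+1)². -/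
theorem comp_left_aux {V : Type*} [NormedAddCommGroup V] [InnerProductSpace ℂ V]
    (B : ℕ → (V →ₗ[ℂ] V)) (i q : ℕ) (h : i < q) (v : V) :
    comp B i q v = comp B (i + 1) q (B (i + 1) v) := by
  induction q with
  | zero => omega
  | succ q ih =>
    rcases Nat.lt_succ_iff_lt_or_eq.mp h with h1 | h1
    · have e1 : comp B i (q + 1) = B (q + 1) ∘ₗ comp B i q := by
        rw [comp, if_pos h1.le]
      have e2 : comp B (i + 1) (q + 1) = B (q + 1) ∘ₗ comp B (i + 1) q := by
        rw [comp, if_pos (Nat.succ_le_of_lt h1)]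
      rw [e1, e2, LinearMap.comp_apply, LinearMap.comp_apply, ih h1]
    · subst h1
      have e1 : comp B i (i + 1) = B (i + 1) ∘ₗ comp B i i := by
        rw [comp, if_pos le_rfl]
      rw [e1, comp_self_aux, comp_self_aux]
      rfl

theorem sq_step_aux (m s T b : ℝ) (hm : 0 < m) (h : s ^ 2 ≤ m * T) :
    (s + b) ^ 2 ≤ (m + 1) * (T + b ^ 2) := by
  have h1 : 0 ≤ m * (T + m * b ^ 2 - 2 * s * b) := by
    nlinarith [sq_nonneg (s - m * b)]
  have h2 := nonneg_of_mul_nonneg_right h1 hm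
  nlinarith

theorem sq_sum_aux (a : ℝ) (b c : ℕ → ℝ) (q : ℕ) :
    (a + ∑ i ∈ Finset.range q, (b i + c i)) ^ 2 ≤
      (2 * (q : ℝ) + 1) * (a ^ 2 + ∑ i ∈ Finset.range q, (b i ^ 2 + c i ^ 2)) := by
  induction q with
  | zero => simp
  | succ q ih =>
    rw [Finset.sum_range_succ, Finset.sum_range_succ]
    have h1 := sq_step_aux _ _ _ (b q) (by positivity) ih
    have h2 := sq_step_aux _ _ _ (c q) (by positivity) h1
    push_cast
    convert h2 using 1 <;> ring

/-- squared form of Lemma 1 (abstract): for any linear `G`,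
`‖G ((B′_q ∘ ⋯ ∘ B′_1) φ₀)‖² ≤ (2q+1) · ( ‖G φ_q‖²`
`  + Σ_{i=0}^{q−1} ( ‖G ((B′_q ∘ ⋯ ∘ B′_{i+1}) (X φ_i))‖²`
`                  + ‖G ((B′_q ∘ ⋯ ∘ B′_{i+2}) (B_{i+1} (X φ_i)))‖² ) )`;
equivalently, the average of the `2q+1` squared norms on the right-hand side is at least
`‖G ((B′_q ∘ ⋯ ∘ B′_1) φ₀)‖² / (2q+1)²`. -/
theorem squared_sum_form {V : Type*} [NormedAddCommGroup V] [InnerProductSpace ℂ V]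
    (φ₀ : V) (q : ℕ) (hq : 1 ≤ q) (B B' : ℕ → (V →ₗ[ℂ] V)) (X : V →ₗ[ℂ] V)
    (hBB' : ∀ k, 1 ≤ k → k ≤ q → B' k ∘ₗ (LinearMap.id - X) = B k ∘ₗ (LinearMap.id - X))
    (G : V →ₗ[ℂ] V) :
    ‖G (comp B' 0 q φ₀)‖ ^ 2
      ≤ (2 * (q : ℝ) + 1) *
          (‖G (comp B 0 q φ₀)‖ ^ 2
            + ∑ i ∈ Finset.range q,
                (‖G (comp B' i q (X (comp B 0 i φ₀)))‖ ^ 2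
                  + ‖G (comp B' (i + 1) q (B (i + 1) (X (comp B 0 i φ₀))))‖ ^ 2)) := by
  have key : ∀ n, n ≤ q → ‖G (comp B' 0 q φ₀)‖ ≤ ‖G (comp B' n q (comp B 0 n φ₀))‖
      + ∑ i ∈ Finset.range n, (‖G (comp B' i q (X (comp B 0 i φ₀)))‖
          + ‖G (comp B' (i + 1) q (B (i + 1) (X (comp B 0 i φ₀))))‖) := by
    intro n
    induction n with
    | zero => intro _; simp [comp]
    | succ n ih =>
      intro hn
      have h := ih (by omega)
      rw [Finset.sum_range_succ]
      have hb := LinearMap.congr_fun (hBB' (n + 1) (by omega) hn) (comp B 0 n φ₀)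
      simp only [LinearMap.comp_apply, LinearMap.sub_apply, LinearMap.id_apply, map_sub] at hb
      have hs : comp B 0 (n + 1) φ₀ = B (n + 1) (comp B 0 n φ₀) := by
        rw [comp, if_pos (Nat.zero_le _)]
        rfl
      have e : G (comp B' n q (comp B 0 n φ₀)) =
          G (comp B' (n + 1) q (comp B 0 (n + 1) φ₀)) + G (comp B' n q (X (comp B 0 n φ₀)))
            - G (comp B' (n + 1) q (B (n + 1) (X (comp B 0 n φ₀)))) := by
        rw [comp_left_aux B' n q hn, comp_left_aux B' n q hn, hs, ← map_add, ← map_add,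
          ← map_sub, ← map_sub, sub_eq_iff_eq_add.mp hb]
        congr 2
        abel
      have t1 := norm_sub_le (G (comp B' (n + 1) q (comp B 0 (n + 1) φ₀))
        + G (comp B' n q (X (comp B 0 n φ₀))))
        (G (comp B' (n + 1) q (B (n + 1) (X (comp B 0 n φ₀)))))
      have t2 := norm_add_le (G (comp B' (n + 1) q (comp B 0 (n + 1) φ₀)))
        (G (comp B' n q (X (comp B 0 n φ₀))))
      rw [← e] at t1
      linarith
  have h := key q le_rfl
  rw [comp_self_aux, LinearMap.id_apply] at h
  exact (pow_le_pow_left₀ (norm_nonneg _) h 2).trans (sq_sum_aux _ _ _ q)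
end

section
/- Grover amplification inequality used in the tightness proof (Theorem 5): for every natural number q and every real θ with 0 ≤ θ and (2q+1)·θ ≤ π/3, one has (q+1)·sin θ ≤ sin((2q+1)·θ); consequently (q+1)²·(sin θ)² ≤ (sin((2q+1)·θ))². -/
open Real

theorem grover_aux (θ : ℝ) (hθ : 0 ≤ θ) (q : ℕ) :
    (2 * (q : ℝ) + 1) * θ ≤ π / 3 →
    ((q : ℝ) + 1) * Real.sin θ ≤ Real.sin ((2 * (q : ℝ) + 1) * θ) := by
  induction q with
  | zero => intro _; simp
  | succ k ih =>
    intro h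
    push_cast at h ⊢
    have hk : (0 : ℝ) ≤ k := Nat.cast_nonneg k
    have hkθ : 0 ≤ (k : ℝ) * θ := mul_nonneg hk hθ
    have ih' := ih (by nlinarith)
    have hs : 0 ≤ Real.sin θ :=
      Real.sin_nonneg_of_nonneg_of_le_pi hθ (by nlinarith [Real.pi_pos])
    have hc : 1 / 2 ≤ Real.cos ((2 * (k : ℝ) + 2) * θ) := by
      rw [← Real.cos_pi_div_three]
      apply Real.cos_le_cos_of_nonneg_of_le_pi
      · nlinarith
      · linarith [Real.pi_pos]
      · nlinarith
    have e1 : (2 * ((k : ℝ) + 1) + 1) * θ = (2 * (k : ℝ) + 2) * θ + θ := by ring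
    have e2 : (2 * (k : ℝ) + 1) * θ = (2 * (k : ℝ) + 2) * θ - θ := by ring
    rw [e1, Real.sin_add]
    rw [e2, Real.sin_sub] at ih'
    nlinarith [mul_le_mul_of_nonneg_right hc hs]

/-- Grover amplification inequality (used in the tightness proof,
Theorem 5): for every `q : ℕ` and real `θ` with `0 ≤ θ` and `(2q+1)θ ≤ π/3`, one has
`(q+1)·sin θ ≤ sin((2q+1)θ)`; consequently `(q+1)²·sin²θ ≤ sin²((2q+1)θ)`. -/
theorem grover_amplification (q : ℕ) (θ : ℝ) (hθ : 0 ≤ θ)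
    (h : (2 * (q : ℝ) + 1) * θ ≤ π / 3) :
    ((q : ℝ) + 1) * Real.sin θ ≤ Real.sin ((2 * (q : ℝ) + 1) * θ) ∧
      ((q : ℝ) + 1) ^ 2 * Real.sin θ ^ 2 ≤ Real.sin ((2 * (q : ℝ) + 1) * θ) ^ 2 := by
  have h1 := grover_aux θ hθ q h
  refine ⟨h1, ?_⟩
  have hq : (0 : ℝ) ≤ q := Nat.cast_nonneg q
  have hs : 0 ≤ Real.sin θ :=
    Real.sin_nonneg_of_nonneg_of_le_pi hθ (by nlinarith [Real.pi_pos, mul_nonneg hq hθ])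
  rw [← mul_pow]
  exact pow_le_pow_left₀ (by positivity) h1 2
end

section
/- Bound on the probability of a bad oracle in the tightness proof (Theorem 5): for every integer q ≥ 1 and all reals c, g with (q²+1)·e²·(5q)⁶ < c and 2·(5q)³ < g, one has (e·(5q)³/c)^(g/c + g/(5q)³) < 1/(c·(q²+1)), where the left-hand side is a real (rpow) power. -/
/-- bound on the probability of a bad oracle in the tightness proof
(Theorem 5): for every integer `q ≥ 1` and reals `c`, `g` with
`(q²+1)·e²·(5q)⁶ < c` and `2·(5q)³ < g`, one has
`(e·(5q)³/c)^(g/c + g/(5q)³) < 1/(c·(q²+1))` (real-exponent power). -/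
theorem bad_oracle_probability_bound (q : ℤ) (hq : 1 ≤ q) (c g : ℝ)
    (hc : ((q : ℝ) ^ 2 + 1) * Real.exp 1 ^ 2 * (5 * (q : ℝ)) ^ 6 < c)
    (hg : 2 * (5 * (q : ℝ)) ^ 3 < g) :
    (Real.exp 1 * (5 * (q : ℝ)) ^ 3 / c) ^ (g / c + g / (5 * (q : ℝ)) ^ 3)
      < 1 / (c * ((q : ℝ) ^ 2 + 1)) := by
  have hq' : (1 : ℝ) ≤ (q : ℝ) := by exact_mod_cast hq
  have hA : (1 : ℝ) ≤ (5 * (q : ℝ)) ^ 3 := one_le_pow₀ (by linarith)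
  have hE : (1 : ℝ) ≤ Real.exp 1 := Real.one_le_exp (by norm_num)
  have hc2 : ((q : ℝ) ^ 2 + 1) * (Real.exp 1 * (5 * (q : ℝ)) ^ 3) ^ 2 < c := by
    have h : ((q : ℝ) ^ 2 + 1) * (Real.exp 1 * (5 * (q : ℝ)) ^ 3) ^ 2
      = ((q : ℝ) ^ 2 + 1) * Real.exp 1 ^ 2 * (5 * (q : ℝ)) ^ 6 := by ring
    rw [h]; exact hc
  clear hc
  generalize (5 * (q : ℝ)) ^ 3 = A at *
  have hEA : 1 ≤ Real.exp 1 * A := one_le_mul_of_one_le_of_one_le hE hA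
  have hB : Real.exp 1 * A < c := by
    nlinarith [mul_nonneg (sq_nonneg (q : ℝ)) (sq_nonneg (Real.exp 1 * A))]
  generalize Real.exp 1 * A = B at *
  have hc0 : 0 < c := by linarith
  have hg0 : 0 < g := by linarith
  have h2 : 2 < g / c + g / A := by
    have h3 : 2 < g / A := by rw [lt_div_iff₀ (by linarith)]; exact hg
    have h4 : 0 < g / c := by positivity
    linarith
  have hx0 : 0 < B / c := div_pos (by linarith) hc0
  have hx1 : B / c < 1 := by rw [div_lt_one hc0]; exact hB
  refine (Real.rpow_lt_rpow_of_exponent_gt hx0 hx1 h2).trans ?_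
  rw [Real.rpow_two, div_pow, div_lt_div_iff₀ (by positivity) (by positivity)]
  nlinarith [mul_lt_mul_of_pos_left hc2 hc0]
end
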